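/- arXiv:2101.01146 — 2 statements merged into one kernel-verified Lean document; each statement's English description precedes it below -/
import Mathlib

section
/- Let (X, d_X) be a metric space on n ≥ 1 points, let μ be a probability measure on X, and let k ≥ 1 be an integer. Then there exist a finite ultrametric space (U, d_U) and a clan embedding (f, χ) of (X, d_X) into (U, d_U) with multiplicative distortion 16k such that E_{x∼μ}[|f(x)|] ≤ 2·(2n)^{1/k}. -/
open Classical in
/-- Pigeonhole on growth ratios. -/
theorem clan_aux_pigeon (k : ℕ) (hk : 1 ≤ k) (a : ℕ → ℝ) (M : ℝ) (h0 : 1 ≤ a 0) (hM : a k ≤ M)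
    (hM1 : 1 ≤ M) :
    ∃ i < k, a (i + 1) * (a 0) ^ (1 / (k : ℝ)) ≤ a i * M ^ (1 / (k : ℝ)) := by
  by_contra! hcon
  set p := (a 0) ^ (1 / (k : ℝ)) with hp
  set q := M ^ (1 / (k : ℝ)) with hq
  have hkr : (k : ℝ) ≠ 0 := by positivity
  have hp0 : 0 < p := Real.rpow_pos_of_pos (by linarith) _
  have hq0 : 0 < q := Real.rpow_pos_of_pos (by linarith) _
  have hpk : p ^ k = a 0 := by
    rw [hp, one_div]; exact Real.rpow_inv_natCast_pow (by linarith) (by omega)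
  have hqk : q ^ k = M := by
    rw [hq, one_div]; exact Real.rpow_inv_natCast_pow (by linarith) (by omega)
  have key : ∀ i ≤ k, a 0 * q ^ i ≤ a i * p ^ i := by
    intro i
    induction i with
    | zero => intro _; simp
    | succ j ih =>
      intro hj
      have h1 := ih (by omega)
      have h2 := (hcon j (by omega)).le
      calc a 0 * q ^ (j + 1) = (a 0 * q ^ j) * q := by ring
        _ ≤ (a j * p ^ j) * q := by gcongr
        _ = (a j * q) * p ^ j := by ring
        _ ≤ (a (j + 1) * p) * p ^ j := by gcongr
        _ = _ := by ring
  obtain ⟨j, rfl⟩ : ∃ j, k = j + 1 := ⟨k - 1, by omega⟩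
  have h1 := key j (by omega)
  have h2 := hcon j (by omega)
  have : a 0 * q ^ (j + 1) < a (j + 1) * p ^ (j + 1) := by
    calc a 0 * q ^ (j + 1) = (a 0 * q ^ j) * q := by ring
        _ ≤ (a j * p ^ j) * q := by gcongr
        _ = (a j * q) * p ^ j := by ring
        _ < (a (j + 1) * p) * p ^ j := by gcongr
        _ = _ := by ring
  rw [hpk, hqk] at this
  nlinarith

/-- Distance on a disjoint union, with constant cross distance. -/
def clanSumDist {A B : Type} (d1 : A → A → ℝ) (d2 : B → B → ℝ) (D : ℝ) : A ⊕ B → A ⊕ B → ℝ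
  | Sum.inl a, Sum.inl b => d1 a b
  | Sum.inr a, Sum.inr b => d2 a b
  | _, _ => D

/-- The inductive invariant. -/
structure ClanInv {X : Type*} [MetricSpace X] (ν : X → ℝ) (k : ℕ) (S : Finset X) (B : ℝ)
    (U : Type) [Fintype U] (d : U → U → ℝ) (π : U → X) (χ : X → U) : Prop where
  self : ∀ u, d u u = 0
  symm : ∀ u v, d u v = d v u
  eq : ∀ u v, d u v = 0 → u = v
  ultra : ∀ u v w, d u w ≤ max (d u v) (d v w)
  mem : ∀ u, π u ∈ S
  dom : ∀ u v, dist (π u) (π v) ≤ d u v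
  le : ∀ u v, d u v ≤ Metric.diam (S : Set X)
  chi : ∀ x ∈ S, π (χ x) = x
  dist : ∀ x ∈ S, ∀ y ∈ S, ∃ y', π y' = y ∧ d y' (χ x) ≤ 16 * k * dist x y
  sum : ∑ u, ν (π u) ≤ B

open Classical in
theorem clan_aux_main {X : Type*} [MetricSpace X] (ν : X → ℝ) (hν : ∀ x, 1 ≤ ν x)
    (k : ℕ) (hk : 1 ≤ k) :
    ∀ (m : ℕ) (S : Finset X), S.card = m → S.Nonempty → ∀ M : ℝ,
      (∀ v ∈ S, ∑ x ∈ S.filter (fun x => dist v x ≤ Metric.diam (S : Set X) / 4), ν x ≤ M) →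
      ∃ (U : Type) (_ : Fintype U) (d : U → U → ℝ) (π : U → X) (χ : X → U),
        ClanInv ν k S ((∑ x ∈ S, ν x) * M ^ (1 / (k : ℝ))) U d π χ := by
  intro m
  induction m using Nat.strong_induction_on with
  | _ m IH =>
  intro S hSm hS M hM
  set D := Metric.diam (S : Set X) with hD
  have hD0 : 0 ≤ D := Metric.diam_nonneg
  have hbd : ∀ T : Finset X, Bornology.IsBounded (T : Set X) := fun T => T.finite_toSet.isBounded
  have hdist : ∀ x ∈ S, ∀ y ∈ S, dist x y ≤ D := fun x hx y hy =>
    Metric.dist_le_diam_of_mem (hbd S) hx hy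
  have hν0 : ∀ x, 0 ≤ ν x := fun x => by linarith [hν x]
  have hmono : ∀ T T' : Finset X, T ⊆ T' → ∑ x ∈ T, ν x ≤ ∑ x ∈ T', ν x := fun T T' h =>
    Finset.sum_le_sum_of_subset_of_nonneg h (fun i _ _ => hν0 i)
  have hball1 : ∀ v ∈ S, ∀ r : ℝ, 0 ≤ r → 1 ≤ ∑ x ∈ S.filter (fun x => dist v x ≤ r), ν x := by
    intro v hv r hr
    have h1 : ({v} : Finset X) ⊆ S.filter (fun x => dist v x ≤ r) := by
      simp [hv, hr]
    have := hmono _ _ h1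
    rw [Finset.sum_singleton] at this
    linarith [hν v]
  have hM1 : 1 ≤ M := by
    obtain ⟨v, hv⟩ := hS
    exact (hball1 v hv _ (by positivity)).trans (hM v hv)
  have hMk : 1 ≤ M ^ (1 / (k : ℝ)) := Real.one_le_rpow hM1 (by positivity)
  rcases hD0.eq_or_lt with hDz | hDp
  · obtain ⟨v, hv⟩ := hS
    have hall : ∀ x ∈ S, x = v := fun x hx =>
      dist_le_zero.1 ((hdist x hx v hv).trans hDz.symm.le)
    refine ⟨Unit, inferInstance, fun _ _ => 0, fun _ => v, fun _ => (), ?_⟩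
    refine ⟨by simp, by simp, by simp, by simp, by simpa using hv, by simp, ?_, ?_, ?_, ?_⟩
    · intro _ _; exact hD0
    · intro x hx; exact (hall x hx).symm
    · intro x hx y hy
      exact ⟨(), (hall y hy).symm, by positivity⟩
    · have h1 := hmono {v} S (by simpa using hv)
      simp only [Finset.sum_singleton, Finset.univ_unique, Finset.sum_const, Finset.card_singleton, one_smul] at h1 ⊢
      nlinarith [hν v]
  · have hkp : (0 : ℝ) < k := by exact_mod_cast hk
    -- the centre
    obtain ⟨v, hv, hvmax⟩ := Finset.exists_max_image S
      (fun v => ∑ x ∈ S.filter (fun x => dist v x ≤ D / 8), ν x) hS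
    set r : ℕ → ℝ := fun i => D / 8 + i * (D / (8 * k)) with hr
    set Bl : ℝ → Finset X := fun s => S.filter (fun x => dist v x ≤ s) with hBl
    have hr0 : r 0 = D / 8 := by simp [hr]
    have hrk : r k = D / 4 := by simp only [hr]; field_simp; norm_num
    have hrs : ∀ i, r (i + 1) = r i + D / (8 * k) := by
      intro i; simp only [hr]; push_cast; ring
    have hgap : 0 < D / (8 * k) := by positivity
    have hrp : ∀ i, 0 < r i := fun i => by simp only [hr]; positivity
    obtain ⟨i, hik, hi⟩ := clan_aux_pigeon k hk (fun i => ∑ x ∈ Bl (r i), ν x) M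
      (hball1 v hv _ (hrp 0).le) (by simp only [hrk]; exact hM v hv) hM1
    set P := Bl (r (i + 1)) with hP
    set Q := Bl (r i) with hQ
    have hri : r (i + 1) ≤ D / 4 := by
      rw [← hrk]; simp only [hr]
      have : ((i + 1 : ℕ) : ℝ) ≤ k := by exact_mod_cast hik
      gcongr
    have hPS : P ⊆ S := Finset.filter_subset _ _
    have hQS : Q ⊆ S := Finset.filter_subset _ _
    have hvQ : v ∈ Q := by simp [hQ, hBl, hv, (hrp i).le]
    have hQP : Q ⊆ P := by
      intro x hx
      simp only [hQ, hP, hBl, Finset.mem_filter] at hx ⊢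
      exact ⟨hx.1, by linarith [hrs i, hx.2]⟩
    have hPd : Metric.diam (P : Set X) ≤ D / 2 := by
      apply Metric.diam_le_of_forall_dist_le (by positivity)
      intro x hx y hy
      simp only [hP, hBl, Finset.coe_filter, Set.mem_setOf_eq] at hx hy
      have := dist_triangle_left x y v
      linarith [hx.2, hy.2]
    have hPne : P ≠ S := by
      intro h; rw [h] at hPd; linarith
    have hPc : P.card < m := by
      rw [← hSm]; exact Finset.card_lt_card (hPS.ssubset_of_ne hPne)
    have hRc : (S \ Q).card < m := by
      rw [← hSm]; apply Finset.card_lt_card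
      refine Finset.sdiff_subset.ssubset_of_ne fun h => ?_
      have := h ▸ hv
      simp [hvQ] at this
    have hRne : (S \ Q).Nonempty := by
      rw [Finset.sdiff_nonempty]
      intro h
      exact hPne (hPS.antisymm (h.trans hQP))
    have hRd : Metric.diam ((S \ Q : Finset X) : Set X) ≤ D :=
      Metric.diam_mono (by exact_mod_cast (Finset.sdiff_subset : S \ Q ⊆ S)) (hbd S)
    obtain ⟨U1, F1, d1, π1, χ1, I1⟩ := IH _ hPc P rfl ⟨v, hQP hvQ⟩ (∑ x ∈ Bl (r 0), ν x) (by
      intro w hw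
      have h1 := hvmax w (hPS hw)
      rw [hr0]
      refine le_trans (hmono _ _ ?_) h1
      intro x hx
      simp only [Finset.mem_filter] at hx ⊢
      exact ⟨hPS hx.1, by linarith [hx.2]⟩)
    obtain ⟨U2, F2, d2, π2, χ2, I2⟩ := IH _ hRc (S \ Q) rfl hRne M (by
      intro w hw
      refine le_trans (hmono _ _ ?_) (hM w (Finset.sdiff_subset hw))
      intro x hx
      rw [Finset.mem_filter] at hx ⊢
      exact ⟨Finset.sdiff_subset hx.1, by linarith [hx.2]⟩)
    have hd1 : ∀ a b, d1 a b ≤ D := fun a b => by linarith [I1.le a b]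
    have hd2 : ∀ a b, d2 a b ≤ D := fun a b => (I2.le a b).trans hRd
    have hRS : S \ Q ⊆ S := Finset.sdiff_subset
    have hmid1 : ∀ x ∈ S, dist v x ≤ r i + D / (16 * k) → x ∈ P := by
      intro x hx h
      simp only [hP, hBl, Finset.mem_filter]
      refine ⟨hx, ?_⟩
      have : D / (16 * k) = D / (8 * k) / 2 := by field_simp; norm_num
      linarith [hrs i]
    have hmid2 : ∀ x ∈ S, ¬ dist v x ≤ r i + D / (16 * k) → x ∈ S \ Q := by
      intro x hx h
      simp only [hQ, hBl, Finset.mem_sdiff, Finset.mem_filter]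
      refine ⟨hx, fun h' => h ?_⟩
      have : 0 < D / (16 * k) := by positivity
      linarith [h'.2]
    have hscale : ∀ t : ℝ, D / (16 * k) ≤ t → D ≤ 16 * k * t := by
      intro t ht
      rw [div_le_iff₀ (by positivity)] at ht
      linarith
    refine ⟨U1 ⊕ U2, inferInstance, clanSumDist d1 d2 D, Sum.elim π1 π2,
      fun x => if dist v x ≤ r i + D / (16 * k) then Sum.inl (χ1 x) else Sum.inr (χ2 x), ?_⟩
    refine ⟨?_, ?_, ?_, ?_, ?_, ?_, ?_, ?_, ?_, ?_⟩
    · rintro (u | u)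
      · exact I1.self u
      · exact I2.self u
    · rintro (u | u) (w | w)
      · exact I1.symm u w
      · rfl
      · rfl
      · exact I2.symm u w
    · rintro (u | u) (w | w) h
      · rw [I1.eq u w h]
      · exact absurd h hDp.ne'
      · exact absurd h hDp.ne'
      · rw [I2.eq u w h]
    · rintro (u | u) (w | w) (z | z) <;> simp only [clanSumDist]
      · exact I1.ultra u w z
      · exact le_max_right _ _
      · exact (hd1 _ _).trans (le_max_left _ _)
      · exact le_max_left _ _
      · exact le_max_left _ _
      · exact (hd2 _ _).trans (le_max_left _ _)
      · exact le_max_right _ _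
      · exact I2.ultra u w z
    · rintro (u | u)
      · exact hPS (I1.mem u)
      · exact hRS (I2.mem u)
    · rintro (u | u) (w | w)
      · exact I1.dom u w
      · exact hdist _ (hPS (I1.mem u)) _ (hRS (I2.mem w))
      · exact hdist _ (hRS (I2.mem u)) _ (hPS (I1.mem w))
      · exact I2.dom u w
    · rintro (u | u) (w | w)
      · exact hd1 u w
      · exact le_rfl
      · exact le_rfl
      · exact hd2 u w
    · intro x hx
      by_cases h : dist v x ≤ r i + D / (16 * k)
      · simp only [h, if_true, Sum.elim_inl]; exact I1.chi x (hmid1 x hx h)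
      · simp only [h, if_false, Sum.elim_inr]; exact I2.chi x (hmid2 x hx h)
    · intro x hx y hy
      have hhalf : D / (16 * k) + D / (16 * k) = D / (8 * k) := by field_simp; norm_num
      by_cases h : dist v x ≤ r i + D / (16 * k)
      · simp only [h, if_true]
        by_cases hyP : y ∈ P
        · obtain ⟨y', h1, h2⟩ := I1.dist x (hmid1 x hx h) y hyP
          exact ⟨Sum.inl y', h1, h2⟩
        · have hyR : y ∈ S \ Q := Finset.mem_sdiff.2 ⟨hy, fun h' => hyP (hQP h')⟩
          refine ⟨Sum.inr (χ2 y), I2.chi y hyR, hscale _ ?_⟩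
          have h3 : r (i + 1) < dist v y := by
            by_contra! h4
            exact hyP (Finset.mem_filter.2 ⟨hy, h4⟩)
          have := dist_triangle v x y
          linarith [hrs i]
      · simp only [h, if_false]
        by_cases hyR : y ∈ S \ Q
        · obtain ⟨y', h1, h2⟩ := I2.dist x (hmid2 x hx h) y hyR
          exact ⟨Sum.inr y', h1, h2⟩
        · have hyQ : y ∈ Q := by
            by_contra h'
            exact hyR (Finset.mem_sdiff.2 ⟨hy, h'⟩)
          refine ⟨Sum.inl (χ1 y), I1.chi y (hQP hyQ), hscale _ ?_⟩
          have h3 : dist v y ≤ r i := (Finset.mem_filter.1 hyQ).2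
          have := dist_triangle v y x
          rw [dist_comm y x] at this
          linarith
    · rw [Fintype.sum_sum_type]
      simp only [Sum.elim_inl, Sum.elim_inr]
      have h1 := I1.sum
      have h2 := I2.sum
      have h3 := Finset.sum_sdiff (f := ν) hQS
      rw [← h3, add_mul]
      linarith


/-- A metric space satisfies the strong (ultrametric) triangle inequality. -/
def IsUltrametricSpace (U : Type*) [iU : MetricSpace U] : Prop :=
  ∀ x y z : U, dist x z ≤ max (dist x y) (dist y z)

/-- A dominating one-to-many embedding: each point has a nonempty clan, clans are
pairwise disjoint, and distances between copies dominate the original distances. -/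
def IsDominatingOneToMany (X Y : Type*) [iX : MetricSpace X] [iY : MetricSpace Y]
    (f : X → Finset Y) : Prop :=
  (∀ x, (f x).Nonempty) ∧
  (∀ x y : X, x ≠ y → Disjoint (f x) (f y)) ∧
  (∀ x y : X, x ≠ y → ∀ x' ∈ f x, ∀ y' ∈ f y, dist x y ≤ dist x' y')

/-- A clan embedding `(f, χ)` with multiplicative distortion `t`. -/
def IsClanEmbedding (X Y : Type*) [iX : MetricSpace X] [iY : MetricSpace Y]
    (f : X → Finset Y) (χ : X → Y) (t : ℝ) : Prop :=
  IsDominatingOneToMany X Y f ∧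
  (∀ x, χ x ∈ f x) ∧
  (∀ x y : X, ∃ y' ∈ f y, dist y' (χ x) ≤ t * dist x y)

/-- for a probability measure `μ` on an `n`-point metric space there is a
clan embedding into an ultrametric with multiplicative distortion `16 k` and expected clan
size `E_{x∼μ}[|f(x)|] ≤ 2·(2n)^{1/k}`. -/
theorem clan_embedding_into_ultrametric_probability
    (X : Type*) [MetricSpace X] [Fintype X] (hn : 1 ≤ Fintype.card X)
    (μ : X → ℝ) (hμ0 : ∀ x, 0 ≤ μ x) (hμ1 : ∑ x, μ x = 1) (k : ℕ) (hk : 1 ≤ k) :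
    ∃ (U : Type) (_ : MetricSpace U) (_ : Fintype U)
      (f : X → Finset U) (χ : X → U),
      IsUltrametricSpace U ∧
      IsClanEmbedding X U f χ (16 * k : ℝ) ∧
      ∑ x, μ x * ((f x).card : ℝ) ≤ 2 * (2 * (Fintype.card X : ℝ)) ^ (1 / (k : ℝ)) := by
  classical
  set n : ℝ := (Fintype.card X : ℝ) with hnn
  have hn0 : 0 < n := by rw [hnn]; exact_mod_cast hn
  have hne : (Finset.univ : Finset X).Nonempty := by
    rw [← Finset.card_pos, Finset.card_univ]; exact hn
  have htot : ∑ x, (1 + n * μ x) = 2 * n := by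
    rw [Finset.sum_add_distrib, ← Finset.mul_sum, hμ1]
    simp [← hnn]; ring
  have hν : ∀ x, 1 ≤ 1 + n * μ x := fun x => by
    have := mul_nonneg hn0.le (hμ0 x)
    linarith
  obtain ⟨U, F, d, π, χ, I⟩ := clan_aux_main (fun x => 1 + n * μ x) hν k hk _ Finset.univ rfl hne
    (2 * n) (by
      intro v _
      rw [← htot]
      exact Finset.sum_le_sum_of_subset_of_nonneg (Finset.subset_univ _)
        (fun i _ _ => by linarith [hν i]))
  let MU : MetricSpace U :=
    { dist := d
      dist_self := I.self
      dist_comm := I.symm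
      dist_triangle := fun u v w => by
        have h1 := dist_nonneg.trans (I.dom u v)
        have h2 := dist_nonneg.trans (I.dom v w)
        exact (I.ultra u v w).trans (max_le (by linarith) (by linarith))
      eq_of_dist_eq_zero := fun {u v} h => I.eq u v h }
  refine ⟨U, MU, F, fun x => Finset.univ.filter (fun u => π u = x), χ, I.ultra,
    ⟨⟨?_, ?_, ?_⟩, ?_, ?_⟩, ?_⟩
  · intro x
    exact ⟨χ x, by simp [I.chi x]⟩
  · intro x y hxy
    rw [Finset.disjoint_left]
    intro u hu hu'
    simp only [Finset.mem_filter, Finset.mem_univ, true_and] at hu hu'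
    exact hxy (hu.symm.trans hu')
  · intro x y _ u hu w hw
    simp only [Finset.mem_filter, Finset.mem_univ, true_and] at hu hw
    subst hu hw
    exact I.dom u w
  · intro x
    simp [I.chi x]
  · intro x y
    obtain ⟨y', h1, h2⟩ := I.dist x (Finset.mem_univ _) y (Finset.mem_univ _)
    exact ⟨y', by simp [h1], h2⟩
  · have h1 : ∑ x, μ x * ((Finset.univ.filter (fun u => π u = x)).card : ℝ) = ∑ u, μ (π u) := by
      rw [← Finset.sum_fiberwise (s := Finset.univ) (g := π)]
      refine Finset.sum_congr rfl fun x _ => ?_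
      rw [Finset.sum_congr rfl (g := fun _ => μ x), Finset.sum_const, nsmul_eq_mul, mul_comm]
      intro u hu
      rw [(Finset.mem_filter.1 hu).2]
    rw [h1]
    have h2 := I.sum
    simp only [htot] at h2
    rw [Finset.sum_add_distrib, ← Finset.mul_sum] at h2
    have h3 : (0 : ℝ) ≤ ∑ _u : U, (1 : ℝ) := Finset.sum_nonneg fun _ _ => zero_le_one
    refine le_of_mul_le_mul_left ?_ hn0
    linarith
end

section
/- There is a universal constant C > 0 such that for every finite metric space (X, d_X) on n ≥ 2 points and every ε ∈ (0,1] there exist a natural number m with 1 ≤ m ≤ C·n·(log₂ n)/ε² and clan embeddings (f_1,χ_1),…,(f_m,χ_m) of (X, d_X) into finite ultrametric spaces, each with multiplicative distortion at most C·(log₂ n)/ε, such that for every x ∈ X one has (1/m)·Σ_{i=1}^m |f_i(x)| ≤ 1 + ε. -/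
/-- Raw data of an ultrametric clan embedding of the finite subset `s`. -/
structure RawClan (X : Type) [MetricSpace X] (s : Finset X) (t : ℝ) where
  U : Type
  fin : Fintype U
  d : U → U → ℝ
  f : X → Finset U
  χ : X → U
  d_self : ∀ x, d x x = 0
  d_symm : ∀ x y, d x y = d y x
  d_pos : ∀ x y, x ≠ y → 0 < d x y
  d_ultra : ∀ x y z, d x z ≤ max (d x y) (d y z)
  d_le : ∀ x y, d x y ≤ Metric.diam (s : Set X)
  f_out : ∀ x, x ∉ s → f x = ∅
  χ_mem : ∀ x ∈ s, χ x ∈ f x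
  dom : ∀ x y, x ≠ y → ∀ x' ∈ f x, ∀ y' ∈ f y, dist x y ≤ d x' y'
  close : ∀ x ∈ s, ∀ y ∈ s, ∃ y' ∈ f y, d y' (χ x) ≤ t * dist x y

lemma finset_diam_bdd {X : Type} [MetricSpace X] (s : Finset X) :
    Bornology.IsBounded (s : Set X) := s.finite_toSet.isBounded

/-- Distance on the disjoint union. -/
def sumDist {U V : Type} (d : U → U → ℝ) (e : V → V → ℝ) (D : ℝ) : U ⊕ V → U ⊕ V → ℝ
  | Sum.inl a, Sum.inl b => d a b
  | Sum.inr a, Sum.inr b => e a b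
  | Sum.inl _, Sum.inr _ => D
  | Sum.inr _, Sum.inl _ => D

open Classical in
/-- Glue two clan embeddings. -/
lemma glue {X : Type} [MetricSpace X] (s s₁ s₂ : Finset X) (t : ℝ)
    (hD : 0 < Metric.diam (s : Set X)) (h₁ : s₁ ⊆ s) (h₂ : s₂ ⊆ s)
    (P : X → Prop)
    (hP : ∀ x ∈ s, P x → ∀ y ∈ s, t * dist x y < Metric.diam (s : Set X) → y ∈ s₁)
    (hnP : ∀ x ∈ s, ¬ P x → ∀ y ∈ s, t * dist x y < Metric.diam (s : Set X) → y ∈ s₂)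
    (hcov : ∀ y ∈ s, y ∈ s₁ ∨ y ∈ s₂)
    (A : RawClan X s₁ t) (B : RawClan X s₂ t) :
    ∃ E : RawClan X s t, ∀ x, (E.f x).card = (A.f x).card + (B.f x).card := by
  have m1 : Metric.diam (s₁ : Set X) ≤ Metric.diam (s : Set X) :=
    Metric.diam_mono (by exact_mod_cast h₁) (finset_diam_bdd s)
  have m2 : Metric.diam (s₂ : Set X) ≤ Metric.diam (s : Set X) :=
    Metric.diam_mono (by exact_mod_cast h₂) (finset_diam_bdd s)
  have hA : ∀ x y, A.d x y ≤ Metric.diam (s : Set X) := fun x y => (A.d_le x y).trans m1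
  have hB : ∀ x y, B.d x y ≤ Metric.diam (s : Set X) := fun x y => (B.d_le x y).trans m2
  have hin1 : ∀ x, ∀ u ∈ A.f x, x ∈ s := by
    intro x u hu
    by_contra hx
    rw [A.f_out x (fun h => hx (h₁ h))] at hu
    simp at hu
  have hin2 : ∀ x, ∀ u ∈ B.f x, x ∈ s := by
    intro x u hu
    by_contra hx
    rw [B.f_out x (fun h => hx (h₂ h))] at hu
    simp at hu
  have self_small : ∀ x : X, t * dist x x < Metric.diam (s : Set X) := by
    intro x; simpa using hD
  have fA := A.fin
  have fB := B.fin
  have hle : ∀ u v, sumDist A.d B.d (Metric.diam (s : Set X)) u v ≤ Metric.diam (s : Set X) := by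
    rintro (u | u) (v | v)
    · exact hA _ _
    · exact le_rfl
    · exact le_rfl
    · exact hB _ _
  refine ⟨{ U := A.U ⊕ B.U
            fin := inferInstance
            d := sumDist A.d B.d (Metric.diam (s : Set X))
            f := fun x => (A.f x).disjSum (B.f x)
            χ := fun x => if P x then Sum.inl (A.χ x) else Sum.inr (B.χ x)
            d_self := ?_
            d_symm := ?_
            d_pos := ?_
            d_ultra := ?_
            d_le := hle
            f_out := ?_
            χ_mem := ?_
            dom := ?_
            close := ?_ }, ?_⟩
  · rintro (u | u)
    · exact A.d_self u
    · exact B.d_self u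
  · rintro (u | u) (v | v)
    · exact A.d_symm _ _
    · rfl
    · rfl
    · exact B.d_symm _ _
  · rintro (u | u) (v | v) huv
    · exact A.d_pos _ _ (fun h => huv (by rw [h]))
    · exact hD
    · exact hD
    · exact B.d_pos _ _ (fun h => huv (by rw [h]))
  · rintro (u | u) (v | v) (w | w)
    · exact A.d_ultra _ _ _
    · exact le_max_right _ _
    · exact (hA _ _).trans (le_max_left _ _)
    · exact le_max_left _ _
    · exact le_max_left _ _
    · exact (hB _ _).trans (le_max_left _ _)
    · exact le_max_right _ _
    · exact B.d_ultra _ _ _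
  · intro x hx
    rw [A.f_out x (fun h => hx (h₁ h)), B.f_out x (fun h => hx (h₂ h))]
    simp
  · intro x hx
    by_cases hp : P x
    · simp only [hp, if_true, Finset.inl_mem_disjSum]
      exact A.χ_mem x (hP x hx hp x hx (self_small x))
    · simp only [hp, if_false, Finset.inr_mem_disjSum]
      exact B.χ_mem x (hnP x hx hp x hx (self_small x))
  · rintro x y hxy (u | u) hu (v | v) hv
    all_goals simp only [Finset.inl_mem_disjSum, Finset.inr_mem_disjSum] at hu hv
    · exact A.dom x y hxy u hu v hv
    · exact Metric.dist_le_diam_of_mem (finset_diam_bdd s) (hin1 x u hu) (hin2 y v hv)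
    · exact Metric.dist_le_diam_of_mem (finset_diam_bdd s) (hin2 x u hu) (hin1 y v hv)
    · exact B.dom x y hxy u hu v hv
  · intro x hx y hy
    by_cases hd : t * dist x y < Metric.diam (s : Set X)
    · by_cases hp : P x
      · obtain ⟨y', hy', h⟩ := A.close x (hP x hx hp x hx (self_small x)) y (hP x hx hp y hy hd)
        refine ⟨Sum.inl y', by simpa using hy', ?_⟩
        simp only [hp, if_true]
        exact h
      · obtain ⟨y', hy', h⟩ := B.close x (hnP x hx hp x hx (self_small x)) y (hnP x hx hp y hy hd)
        refine ⟨Sum.inr y', by simpa using hy', ?_⟩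
        simp only [hp, if_false]
        exact h
    · have hd' := not_lt.1 hd
      rcases hcov y hy with h | h
      · exact ⟨Sum.inl (A.χ y), by simpa using A.χ_mem y h, (hle _ _).trans hd'⟩
      · exact ⟨Sum.inr (B.χ y), by simpa using B.χ_mem y h, (hle _ _).trans hd'⟩
  · intro x
    simp [Finset.card_disjSum]

lemma growth (k : ℕ) (hk : 0 < k) (M : ℕ → ℝ) (h0 : ∀ i, 0 < M i) :
    ∃ i < k, M (i + 1) ≤ M i * (M k / M 0) ^ ((1 : ℝ) / k) := by
  by_contra! h
  set q := (M k / M 0) ^ ((1 : ℝ) / k) with hq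
  have hq0 : 0 < q := Real.rpow_pos_of_pos (div_pos (h0 _) (h0 _)) _
  have hqk : q ^ k = M k / M 0 := by
    rw [hq, ← Real.rpow_natCast, ← Real.rpow_mul (div_pos (h0 _) (h0 _)).le,
      one_div_mul_cancel (by positivity), Real.rpow_one]
  have key : ∀ j, j + 1 ≤ k → M 0 * q ^ (j + 1) < M (j + 1) := by
    intro j
    induction j with
    | zero => intro hj; simpa using h 0 (by omega)
    | succ j ih =>
      intro hj
      have := ih (by omega)
      calc M 0 * q ^ (j + 1 + 1) = (M 0 * q ^ (j + 1)) * q := by ring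
        _ < M (j + 1) * q := by gcongr
        _ < _ := h (j + 1) (by omega)
  obtain ⟨j, rfl⟩ : ∃ j, k = j + 1 := ⟨k - 1, by omega⟩
  have := key j le_rfl
  rw [hqk, mul_div_cancel₀ _ (h0 0).ne'] at this
  exact lt_irrefl _ this

open Classical in
lemma raw_exists {X : Type} [MetricSpace X] [Fintype X] (μ : X → ℝ) (hμ : ∀ x, 1 ≤ μ x)
    (k : ℕ) (hk : 0 < k) :
    ∀ (N : ℕ) (s : Finset X), s.card = N → s.Nonempty → ∀ M : ℝ,
      (∀ u ∈ s, ∑ x ∈ s.filter (fun x => dist u x ≤ Metric.diam (s : Set X) / 4), μ x ≤ M) →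
      ∃ E : RawClan X s (16 * k),
        ∑ x, μ x * ((E.f x).card : ℝ) ≤ (∑ x ∈ s, μ x) * M ^ ((1 : ℝ) / k) := by
  intro N
  induction N using Nat.strong_induction_on with
  | _ N IH =>
  intro s hsN hs M hM
  have hμ0 : ∀ x, 0 ≤ μ x := fun x => zero_le_one.trans (hμ x)
  have hk' : (0 : ℝ) < k := by exact_mod_cast hk
  rcases s.eq_singleton_or_nontrivial hs.choose_spec with h1 | hnt
  · generalize hs.choose = a at h1
    subst h1
    have hM1 : 1 ≤ M := by
      have := hM a (by simp)
      rw [Finset.filter_singleton] at this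
      simp at this
      exact (hμ a).trans this
    refine ⟨{ U := Unit
              fin := inferInstance
              d := fun _ _ => 0
              f := fun x => if x = a then {()} else ∅
              χ := fun _ => ()
              d_self := by simp
              d_symm := by simp
              d_pos := fun x y h => absurd rfl h
              d_ultra := by simp
              d_le := fun _ _ => Metric.diam_nonneg
              f_out := fun x hx => if_neg (fun h => hx (Finset.mem_singleton.2 h))
              χ_mem := by simp
              dom := ?_
              close := ?_ }, ?_⟩
    · intro x y hxy x' hx' y' hy'
      by_cases h1 : x = a <;> by_cases h2 : y = a <;> simp_all
    · intro x hx y hy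
      simp at hx hy
      subst hx; subst hy
      simp
    · have : ∀ x, μ x * (((if x = a then ({()} : Finset Unit) else ∅).card : ℕ) : ℝ)
          = if x = a then μ x else 0 := by
        intro x; split_ifs <;> simp
      simp only [this]
      simp
      exact le_mul_of_one_le_right (hμ0 a) (Real.one_le_rpow hM1 (by positivity))
  · set Δ := Metric.diam (s : Set X) with hΔ
    have hΔ0 : 0 < Δ := by
      obtain ⟨x, hx, y, hy, hxy⟩ := hnt
      exact (dist_pos.2 hxy).trans_le (Metric.dist_le_diam_of_mem (finset_diam_bdd s) hx hy)
    let b : X → ℝ → Finset X := fun v r => s.filter (fun x => dist v x ≤ r)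
    obtain ⟨v, hv, hmax⟩ := Finset.exists_max_image s (fun u => ∑ x ∈ b u (Δ / 8), μ x) hs
    set δ := Δ / (8 * k) with hδ
    have hδ0 : 0 < δ := by positivity
    have hkδ : k * δ = Δ / 8 := by rw [hδ]; field_simp
    let Mf : ℕ → ℝ := fun i => ∑ x ∈ b v (Δ / 8 + i * δ), μ x
    have hMf : ∀ i, 0 < Mf i := by
      intro i
      apply Finset.sum_pos (fun x _ => zero_lt_one.trans_le (hμ x))
      exact ⟨v, by simp [b, hv]; positivity⟩
    obtain ⟨i, hik, hi⟩ := growth k hk Mf hMf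
    have hMf0 : Mf 0 = ∑ x ∈ b v (Δ / 8), μ x := by simp [Mf]
    have hMfk : Mf k ≤ M := by
      have : Δ / 8 + k * δ = Δ / 4 := by rw [hkδ]; ring
      simp only [Mf, this]
      exact hM v hv
    set r := Δ / 8 + i * δ with hr
    have hr0 : 0 < r := by positivity
    have hr1 : Δ / 8 + ((i + 1 : ℕ) : ℝ) * δ = r + δ := by push_cast; rw [hr]; ring
    have hr2 : r + δ ≤ Δ / 4 := by
      have : ((i + 1 : ℕ) : ℝ) * δ ≤ k * δ := by
        gcongr; exact_mod_cast hik
      rw [← hr1]; linarith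
    set s₁ := b v (r + δ) with hs₁
    set s₂ := s \ b v r with hs₂
    have h₁ : s₁ ⊆ s := Finset.filter_subset _ _
    have h₂ : s₂ ⊆ s := Finset.sdiff_subset
    have hvb : v ∈ b v r := by simp [b, hv]; exact hr0.le
    have hvs₁ : v ∈ s₁ := by simp [s₁, b, hv]; positivity
    have hdiam₁ : Metric.diam (s₁ : Set X) ≤ Δ / 2 := by
      apply Metric.diam_le_of_forall_dist_le (by positivity)
      intro x hx y hy
      simp [s₁, b] at hx hy
      have := dist_triangle_left x y v
      linarith [hx.2, hy.2]
    have hne₁ : s₁ ≠ s := by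
      intro h
      rw [h] at hdiam₁
      linarith
    have hc₁ : s₁.card < N := by
      rw [← hsN]; exact Finset.card_lt_card (h₁.ssubset_of_ne hne₁)
    have hc₂ : s₂.card < N := by
      rw [← hsN]
      apply Finset.card_lt_card (h₂.ssubset_of_ne _)
      intro h
      have : v ∈ s₂ := h ▸ hv
      exact (Finset.mem_sdiff.1 this).2 hvb
    have hn₂ : s₂.Nonempty := by
      obtain ⟨y, hy⟩ : ∃ y, y ∈ s \ s₁ := by
        rw [← Finset.Nonempty, Finset.sdiff_nonempty]
        exact fun h => hne₁ (Finset.Subset.antisymm h₁ h)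
      refine ⟨y, ?_⟩
      simp [s₁, s₂, b] at hy ⊢
      refine ⟨hy.1, fun _ => ?_⟩
      linarith [hy.2 hy.1]
    have mono : ∀ A B : Finset X, A ⊆ B → ∑ x ∈ A, μ x ≤ ∑ x ∈ B, μ x := fun A B h =>
      Finset.sum_le_sum_of_subset_of_nonneg h (fun x _ _ => hμ0 x)
    obtain ⟨A, hA⟩ := IH _ hc₁ s₁ rfl ⟨v, hvs₁⟩ (Mf 0) (by
      intro u hu
      rw [hMf0]
      refine le_trans (mono _ (b u (Δ / 8)) ?_) (hmax u (h₁ hu))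
      intro x hx
      simp only [Finset.mem_filter, b] at hx ⊢
      exact ⟨h₁ hx.1, by linarith [hx.2]⟩)
    have hdiam₂ : Metric.diam (s₂ : Set X) ≤ Δ :=
      Metric.diam_mono (by exact_mod_cast h₂) (finset_diam_bdd s)
    obtain ⟨B, hB⟩ := IH _ hc₂ s₂ rfl hn₂ M (by
      intro u hu
      refine le_trans (mono _ _ ?_) (hM u (h₂ hu))
      intro x hx
      simp only [Finset.mem_filter] at hx ⊢
      exact ⟨h₂ hx.1, by linarith [hx.2]⟩)
    have small : ∀ x y : X, 16 * (k : ℝ) * dist x y < Δ → dist x y < δ / 2 := by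
      intro x y h
      have : 16 * (k : ℝ) * (δ / 2) = Δ := by linarith [hkδ]
      rw [← this] at h
      exact lt_of_mul_lt_mul_left h (by positivity)
    obtain ⟨E, hE⟩ := glue s s₁ s₂ (16 * k) hΔ0 h₁ h₂ (fun x => dist v x ≤ r + δ / 2)
      (by
        intro x hx hp y hy hd
        have := small x y hd
        have := dist_triangle v x y
        simp only [s₁, b, Finset.mem_filter]
        exact ⟨hy, by linarith⟩)
      (by
        intro x hx hp y hy hd
        have := small x y hd
        have := dist_triangle_right v x y
        simp only [s₂, b, Finset.mem_filter, Finset.mem_sdiff]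
        exact ⟨hy, fun h => hp (by linarith [h.2])⟩)
      (by
        intro y hy
        by_cases h : dist v y ≤ r
        · left; simp only [s₁, b, Finset.mem_filter]; exact ⟨hy, by linarith⟩
        · right; simp only [s₂, b, Finset.mem_filter, Finset.mem_sdiff]
          exact ⟨hy, fun h' => h h'.2⟩)
      A B
    refine ⟨E, ?_⟩
    have e1 : ∑ x, μ x * ((E.f x).card : ℝ)
        = ∑ x, μ x * ((A.f x).card : ℝ) + ∑ x, μ x * ((B.f x).card : ℝ) := by
      rw [← Finset.sum_add_distrib]
      apply Finset.sum_congr rfl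
      intro x _
      rw [hE]; push_cast; ring
    have e2 : ∑ x ∈ s, μ x = ∑ x ∈ s₂, μ x + Mf i :=
      (Finset.sum_sdiff (Finset.filter_subset _ _)).symm
    have e3 : ∑ x ∈ s₁, μ x = Mf (i + 1) := by
      simp only [Mf, hr1, s₁]
    have hM0 : 0 < M := (hMf k).trans_le hMfk
    have e4 : Mf (i + 1) * Mf 0 ^ ((1 : ℝ) / k) ≤ Mf i * M ^ ((1 : ℝ) / k) := by
      calc Mf (i + 1) * Mf 0 ^ ((1 : ℝ) / k)
          ≤ (Mf i * (Mf k / Mf 0) ^ ((1 : ℝ) / k)) * Mf 0 ^ ((1 : ℝ) / k) :=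
            mul_le_mul_of_nonneg_right hi (Real.rpow_nonneg (hMf 0).le _)
        _ = Mf i * Mf k ^ ((1 : ℝ) / k) := by
            rw [mul_assoc, ← Real.mul_rpow (div_pos (hMf k) (hMf 0)).le (hMf 0).le,
              div_mul_cancel₀ _ (hMf 0).ne']
        _ ≤ _ := mul_le_mul_of_nonneg_left
            (Real.rpow_le_rpow (hMf k).le hMfk (by positivity)) (hMf i).le
    rw [e1, e2, add_mul]
    rw [e3] at hA
    linarith

/-- Bundled clan embeddings into finite ultrametrics. -/
structure BClan (X : Type) [MetricSpace X] (t : ℝ) where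
  U : Type
  inst : MetricSpace U
  fin : Fintype U
  f : X → Finset U
  χ : X → U
  ultra : IsUltrametricSpace U (iU := inst)
  clan : IsClanEmbedding X U f χ t (iY := inst)

/-- The metric space of a raw clan embedding. -/
@[reducible] def RawClan.metric {X : Type} [MetricSpace X] {s : Finset X} {t : ℝ}
    (E : RawClan X s t) : MetricSpace E.U where
  dist := E.d
  dist_self := E.d_self
  dist_comm := E.d_symm
  dist_triangle := by
    have nn : ∀ x y, 0 ≤ E.d x y := by
      intro x y
      by_cases h : x = y
      · rw [h, E.d_self]
      · exact (E.d_pos x y h).le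
    intro x y z
    exact (E.d_ultra x y z).trans (max_le_add_of_nonneg (nn _ _) (nn _ _))
  eq_of_dist_eq_zero := by
    intro x y h
    by_contra hne
    exact (E.d_pos x y hne).ne' h

lemma RawClan.toB {X : Type} [MetricSpace X] [Fintype X] {t t' : ℝ} (htt : t ≤ t')
    (E : RawClan X Finset.univ t) :
    ∃ F : BClan X t', ∀ x, (F.f x).card = (E.f x).card := by
  refine ⟨{ U := E.U
            inst := E.metric
            fin := E.fin
            f := E.f
            χ := E.χ
            ultra := E.d_ultra
            clan := ⟨⟨fun x => ⟨_, E.χ_mem x (Finset.mem_univ x)⟩, ?_, E.dom⟩,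
              fun x => E.χ_mem x (Finset.mem_univ x), ?_⟩ }, fun x => rfl⟩
  · intro x y hxy
    rw [Finset.disjoint_left]
    intro a ha hb
    have h1 := E.dom x y hxy a ha a hb
    rw [E.d_self] at h1
    exact absurd (dist_pos.2 hxy) (not_lt.2 h1)
  · intro x y
    obtain ⟨y', hy', h⟩ := E.close x (Finset.mem_univ _) y (Finset.mem_univ _)
    exact ⟨y', hy', h.trans (mul_le_mul_of_nonneg_right htt dist_nonneg)⟩

lemma exp_le_two {t : ℝ} (h0 : 0 ≤ t) (h1 : t ≤ 1) : Real.exp t ≤ 1 + 2 * t := by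
  have := Real.abs_exp_sub_one_le (x := t) (by rwa [abs_of_nonneg h0])
  rw [abs_of_nonneg h0] at this
  linarith [le_abs_self (Real.exp t - 1)]

/-- One step: a good clan embedding with respect to given weights. -/
lemma one_step {X : Type} [MetricSpace X] [Fintype X] (hX : 2 ≤ Fintype.card X)
    (e t : ℝ) (he : 0 < e) (he1 : e ≤ 1) (k : ℕ) (hk : 0 < k)
    (hke : Real.log (2 * Fintype.card X) / k ≤ e / 2) (hkt : 16 * (k : ℝ) ≤ t)
    (w : X → ℝ) (hw : ∀ x, 0 < w x) :
    ∃ F : BClan X t, (∀ x, 0 ≤ ((F.f x).card : ℝ) - 1) ∧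
      (∀ x, ((F.f x).card : ℝ) - 1 ≤ 2 * Fintype.card X * e) ∧
      ∑ x, w x * (((F.f x).card : ℝ) - 1) ≤ 2 * e * ∑ x, w x := by
  have hn : (0 : ℝ) < Fintype.card X := by exact_mod_cast (by omega : 0 < Fintype.card X)
  have hk' : (0 : ℝ) < k := by exact_mod_cast hk
  have hne : Nonempty X := Fintype.card_pos_iff.1 (by omega)
  set n : ℝ := (Fintype.card X : ℝ) with hn'
  set W := ∑ x, w x with hW
  have hW0 : 0 < W := Finset.sum_pos (fun x _ => hw x) Finset.univ_nonempty
  let μ : X → ℝ := fun x => n * w x / W + 1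
  have hμ : ∀ x, 1 ≤ μ x := by
    intro x
    have : 0 ≤ n * w x / W := by have := hw x; positivity
    simp only [μ]; linarith
  have hsum : ∑ x, μ x = 2 * n := by
    simp only [μ]
    rw [Finset.sum_add_distrib, ← Finset.sum_div, ← Finset.mul_sum, ← hW]
    simp only [Finset.sum_const, Finset.card_univ, nsmul_eq_mul, mul_one]
    rw [mul_div_cancel_right₀ _ hW0.ne']; ring
  obtain ⟨E, hE⟩ := raw_exists μ hμ k hk _ Finset.univ rfl Finset.univ_nonempty (2 * n) (by
    intro u _
    rw [← hsum]
    exact Finset.sum_le_sum_of_subset_of_nonneg (Finset.filter_subset _ _)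
      (fun x _ _ => zero_le_one.trans (hμ x)))
  obtain ⟨F, hF⟩ := E.toB hkt
  have hpow : (2 * n) ^ ((1 : ℝ) / k) ≤ 1 + e := by
    rw [Real.rpow_def_of_pos (by positivity), mul_one_div]
    refine (Real.exp_le_exp.2 hke).trans ?_
    have := exp_le_two (t := e / 2) (by positivity) (by linarith)
    linarith
  rw [hsum] at hE
  have hE2 : ∑ x, μ x * (((F.f x).card : ℝ) - 1) ≤ 2 * n * e := by
    have : ∑ x, μ x * (((F.f x).card : ℝ) - 1)
        = ∑ x, μ x * ((E.f x).card : ℝ) - ∑ x, μ x := by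
      rw [← Finset.sum_sub_distrib]
      exact Finset.sum_congr rfl (fun x _ => by rw [hF]; ring)
    rw [this, hsum]
    nlinarith [mul_le_mul_of_nonneg_left hpow (by positivity : 0 ≤ 2 * n)]
  have hc : ∀ x, 0 ≤ ((F.f x).card : ℝ) - 1 := by
    intro x
    have : 1 ≤ (F.f x).card := Finset.card_pos.2 (F.clan.1.1 x)
    have : (1 : ℝ) ≤ (F.f x).card := by exact_mod_cast this
    linarith
  refine ⟨F, hc, ?_, ?_⟩
  · intro x
    have h1 : μ x * (((F.f x).card : ℝ) - 1) ≤ ∑ x, μ x * (((F.f x).card : ℝ) - 1) :=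
      Finset.single_le_sum (f := fun x => μ x * (((F.f x).card : ℝ) - 1))
        (fun y _ => mul_nonneg (zero_le_one.trans (hμ y)) (hc y)) (Finset.mem_univ x)
    have h2 := mul_le_mul_of_nonneg_right (hμ x) (hc x)
    linarith
  · have h1 : ∑ x, (n / W) * (w x * (((F.f x).card : ℝ) - 1))
        ≤ ∑ x, μ x * (((F.f x).card : ℝ) - 1) := by
      apply Finset.sum_le_sum
      intro x _
      have : μ x * (((F.f x).card : ℝ) - 1)
        = (n / W) * (w x * (((F.f x).card : ℝ) - 1)) + (((F.f x).card : ℝ) - 1) := by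
        simp only [μ]; ring
      rw [this]; linarith [hc x]
    rw [← Finset.mul_sum] at h1
    have h2 := h1.trans hE2
    rw [div_mul_eq_mul_div, div_le_iff₀ hW0] at h2
    have h3 : n * ∑ x, w x * (((F.f x).card : ℝ) - 1) ≤ n * (2 * e * W) := by linarith
    exact le_of_mul_le_mul_left h3 hn

/-- Multiplicative weights. -/
lemma mwu {X : Type} [Fintype X] {E : Type*} (c : E → X → ℝ) (e η : ℝ) (hη : 0 ≤ η)
    (step : ∀ w : X → ℝ, (∀ x, 0 < w x) → ∃ F : E, (∀ x, 0 ≤ c F x) ∧ (∀ x, η * c F x ≤ 1) ∧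
      ∑ x, w x * c F x ≤ e * ∑ x, w x) (m : ℕ) :
    ∃ g : Fin m → E, ∑ x, Real.exp (η * ∑ i, c (g i) x)
      ≤ Fintype.card X * Real.exp (2 * η * e * m) := by
  induction m with
  | zero => exact ⟨Fin.elim0, by simp⟩
  | succ m ih =>
    obtain ⟨g, hg⟩ := ih
    obtain ⟨F, h0, h1, h2⟩ := step (fun x => Real.exp (η * ∑ i, c (g i) x))
      (fun x => Real.exp_pos _)
    refine ⟨Fin.snoc g F, ?_⟩
    set w : X → ℝ := fun x => Real.exp (η * ∑ i, c (g i) x) with hw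
    have hW : 0 ≤ ∑ x, w x := Finset.sum_nonneg (fun x _ => (Real.exp_pos _).le)
    calc ∑ x, Real.exp (η * ∑ i, c ((Fin.snoc g F : Fin (m + 1) → E) i) x)
        = ∑ x, w x * Real.exp (η * c F x) := by
          apply Finset.sum_congr rfl
          intro x _
          rw [Fin.sum_univ_castSucc]
          simp only [Fin.snoc_castSucc, Fin.snoc_last, mul_add, Real.exp_add, hw]
      _ ≤ ∑ x, w x * (1 + 2 * (η * c F x)) := by
          apply Finset.sum_le_sum
          intro x _
          exact mul_le_mul_of_nonneg_left
            (exp_le_two (mul_nonneg hη (h0 x)) (h1 x)) (Real.exp_pos _).le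
      _ = ∑ x, w x + 2 * η * ∑ x, w x * c F x := by
          rw [Finset.mul_sum, ← Finset.sum_add_distrib]
          exact Finset.sum_congr rfl (fun x _ => by ring)
      _ ≤ ∑ x, w x + 2 * η * (e * ∑ x, w x) := by gcongr
      _ = (∑ x, w x) * (2 * η * e + 1) := by ring
      _ ≤ (∑ x, w x) * Real.exp (2 * η * e) :=
          mul_le_mul_of_nonneg_left (Real.add_one_le_exp _) hW
      _ ≤ (Fintype.card X * Real.exp (2 * η * e * m)) * Real.exp (2 * η * e) :=
          mul_le_mul_of_nonneg_right hg (Real.exp_pos _).le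
      _ = _ := by
          rw [mul_assoc, ← Real.exp_add]; push_cast; ring_nf

/-- a uniform distribution over `m ≤ C·n·log₂(n)/ε²` clan embeddings into
ultrametrics, each with multiplicative distortion at most `C·log₂(n)/ε`, so that the
expected clan size of every point is at most `1 + ε`. -/
theorem uniform_distribution_clan_embeddings_eps :
    ∃ C : ℝ, 0 < C ∧
      ∀ (X : Type) [MetricSpace X] [Fintype X], 2 ≤ Fintype.card X →
      ∀ ε : ℝ, 0 < ε → ε ≤ 1 →
      ∃ m : ℕ, 1 ≤ m ∧
        (m : ℝ) ≤ C * (Fintype.card X : ℝ) * Real.logb 2 (Fintype.card X) / ε ^ 2 ∧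
        ∃ (U : Fin m → Type) (dU : ∀ i, MetricSpace (U i)) (_ : ∀ i, Fintype (U i))
          (f : ∀ i, X → Finset (U i)) (χ : ∀ i, X → U i),
          (∀ i, IsUltrametricSpace (U i) (iU := dU i)) ∧
          (∀ i, IsClanEmbedding X (U i) (f i) (χ i)
              (C * Real.logb 2 (Fintype.card X) / ε) (iY := dU i)) ∧
          ∀ x : X, (∑ i, ((f i x).card : ℝ)) / (m : ℝ) ≤ 1 + ε := by
  refine ⟨400, by norm_num, ?_⟩
  intro X _ _ hX ε hε hε1
  set n : ℝ := (Fintype.card X : ℝ) with hn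
  have hn2 : (2 : ℝ) ≤ n := by rw [hn]; exact_mod_cast hX
  have hn0 : 0 < n := by linarith
  set L := Real.logb 2 n with hL
  have hL1 : 1 ≤ L := by
    rw [hL, Real.le_logb_iff_rpow_le (by norm_num) hn0]; simpa using hn2
  have hlogpos : 0 < Real.log n := Real.log_pos (by linarith)
  have hlogL : Real.log n ≤ L := by
    rw [hL, Real.logb, le_div_iff₀ (Real.log_pos (by norm_num))]
    have : Real.log 2 ≤ 1 := by linarith [Real.log_two_lt_d9]
    nlinarith
  have hlog2n : Real.log (2 * n) ≤ 2 * L := by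
    rw [Real.log_mul (by norm_num) hn0.ne']
    have : Real.log 2 ≤ Real.log n := Real.log_le_log (by norm_num) hn2
    linarith
  have hlog2n0 : 0 < Real.log (2 * n) := Real.log_pos (by linarith)
  set e := ε / 5 with he
  have he0 : 0 < e := by positivity
  obtain ⟨k, hk⟩ : ∃ k : ℕ, k = ⌈2 * Real.log (2 * n) / e⌉₊ := ⟨_, rfl⟩
  have hk1 : 2 * Real.log (2 * n) / e ≤ k := hk ▸ Nat.le_ceil _
  have hk2 : (k : ℝ) < 2 * Real.log (2 * n) / e + 1 := hk ▸ Nat.ceil_lt_add_one (by positivity)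
  have hk0 : (0 : ℝ) < k := lt_of_lt_of_le (by positivity) hk1
  have hLe : 1 ≤ L / ε := by rw [le_div_iff₀ hε]; linarith
  have hkt : 16 * (k : ℝ) ≤ 400 * L / ε := by
    have h1 : 2 * Real.log (2 * n) / e ≤ 20 * (L / ε) := by
      rw [he]
      rw [div_le_iff₀ (by positivity)]
      have : 20 * (L / ε) * (ε / 5) = 4 * L := by field_simp; norm_num
      linarith
    have : 400 * L / ε = 400 * (L / ε) := by ring
    rw [this]; linarith
  have hke : Real.log (2 * n) / k ≤ e / 2 := by
    rw [div_le_iff₀ hk0]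
    rw [div_le_iff₀ he0] at hk1
    linarith
  obtain ⟨m, hm⟩ : ∃ m : ℕ, m = ⌈2 * n * Real.log n⌉₊ := ⟨_, rfl⟩
  have hm1 : 2 * n * Real.log n ≤ m := hm ▸ Nat.le_ceil _
  have hm2 : (m : ℝ) < 2 * n * Real.log n + 1 := hm ▸ Nat.ceil_lt_add_one (by positivity)
  have hm0 : (0 : ℝ) < m := lt_of_lt_of_le (by positivity) hm1
  have hη : 0 < 1 / (2 * n * e) := by positivity
  obtain ⟨g, hg⟩ := mwu (X := X) (E := BClan X (400 * L / ε))
    (fun F x => ((F.f x).card : ℝ) - 1) (2 * e) (1 / (2 * n * e)) hη.le (by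
      intro w hw
      obtain ⟨F, h0, h1, h2⟩ := one_step hX e (400 * L / ε) he0 (by rw [he]; linarith) k
        (by exact_mod_cast hk0) hke hkt w hw
      refine ⟨F, h0, ?_, h2⟩
      intro x
      rw [one_div_mul_eq_div, div_le_one (by positivity)]
      exact h1 x) m
  refine ⟨m, by exact_mod_cast hm0, ?_, fun i => (g i).U, fun i => (g i).inst,
    fun i => (g i).fin, fun i => (g i).f, fun i => (g i).χ, fun i => (g i).ultra,
    fun i => (g i).clan, ?_⟩
  · rw [le_div_iff₀ (by positivity)]
    have h1 : n * Real.log n ≤ n * L := by gcongr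
    have h2 : 1 ≤ n * L := by nlinarith
    have h3 : ε ^ 2 ≤ 1 := by nlinarith
    have h4 : (m : ℝ) ≤ 3 * (n * L) := by linarith
    nlinarith
  · intro x
    have h1 : Real.exp (1 / (2 * n * e) * ∑ i, (((g i).f x).card - 1 : ℝ))
        ≤ n * Real.exp (2 * (1 / (2 * n * e)) * (2 * e) * m) :=
      (Finset.single_le_sum
        (f := fun x => Real.exp (1 / (2 * n * e) * ∑ i, (((g i).f x).card - 1 : ℝ)))
        (fun y _ => (Real.exp_pos _).le) (Finset.mem_univ x)).trans hg
    have h2 := Real.log_le_log (Real.exp_pos _) h1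
    rw [Real.log_exp, Real.log_mul hn0.ne' (Real.exp_pos _).ne', Real.log_exp,
      one_div_mul_eq_div, div_le_iff₀ (by positivity)] at h2
    rw [Finset.sum_sub_distrib] at h2
    simp only [Finset.sum_const, Finset.card_univ, Fintype.card_fin, nsmul_eq_mul, mul_one] at h2
    have h3 : (Real.log n + 2 * (1 / (2 * n * e)) * (2 * e) * m) * (2 * n * e)
        = 2 * n * Real.log n * e + 4 * e * m := by field_simp; ring
    rw [h3] at h2
    have h4 : 2 * n * Real.log n * e ≤ m * e := by gcongr
    rw [div_le_iff₀ hm0]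
    have h5 : ∑ i, (((g i).f x).card : ℝ) ≤ m + 5 * e * m := by linarith
    have h6 : (m : ℝ) + 5 * e * m = (1 + ε) * m := by rw [he]; ring
    exact h5.trans h6.le
end
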